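/- arXiv:1804.01119 — 3 statements merged into one kernel-verified Lean document; each statement's English description precedes it below -/
import Mathlib

section
/- Let X ∈ ℝ^{n×p} have ℓ₂-normalized columns, T₀ ⊂ {1,...,p} with |T₀| = s₀, and j ∉ T₀. Let λ_{s₀} denote the s₀-th largest eigenvalue of X_{T₀}X_{T₀}ᵗ. Then the (s₀+1)-th largest eigenvalue of X_{T₀}X_{T₀}ᵗ + X_j X_jᵗ satisfies λ_{s₀+1}(X_{T₀}X_{T₀}ᵗ + X_jX_jᵗ) ≥ (1 + λ_{s₀} − √((1−λ_{s₀})² + 4‖X_{T₀}ᵗ X_j‖₂²))/2. -/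
open Matrix Polynomial BigOperators

/-- A lower bound on the spectrum of a real symmetric matrix is the same as a lower bound on its
quadratic form. -/
theorem Matrix.IsHermitian.forall_le_eigenvalues_iff {ι : Type*} [Fintype ι] [DecidableEq ι]
    {G : Matrix ι ι ℝ} (hG : G.IsHermitian) (t : ℝ) :
    (∀ i, t ≤ hG.eigenvalues i) ↔ ∀ v : ι → ℝ, t * (v ⬝ᵥ v) ≤ v ⬝ᵥ (G *ᵥ v) := by
  have hH : (G - algebraMap ℝ _ t).IsHermitian := by
    refine hG.sub ?_
    rw [Matrix.algebraMap_eq_diagonal]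
    exact Matrix.isHermitian_diagonal _
  have hspec : (∀ i, t ≤ hG.eigenvalues i) ↔ (G - algebraMap ℝ _ t).PosSemidef := by
    rw [Matrix.posSemidef_iff_isHermitian_and_spectrum_nonneg, ← spectrum.sub_singleton_eq,
      hG.spectrum_real_eq_range_eigenvalues]
    simp only [hH, true_and]
    simp [Set.subset_def]
  rw [hspec, Matrix.posSemidef_iff_dotProduct_mulVec]
  simp only [hH, true_and]
  simp [Matrix.sub_mulVec, Algebra.algebraMap_eq_smul_one, Matrix.smul_mulVec, dotProduct_sub]

/-- If the characteristic polynomial of `N * Nᵀ` splits with roots `l`, then `l` and the eigenvalues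
of `Nᵀ * N` agree up to zeros. -/
theorem Matrix.replicate_zero_add_map_roots_eq {n : ℕ} {ι : Type*} [Fintype ι] [DecidableEq ι]
    (N : Matrix (Fin n) ι ℝ) (hG : (Nᵀ * N).IsHermitian) (l : Fin n → ℝ)
    (hl : (N * Nᵀ).charpoly = ∏ i, (X - C (l i))) :
    Multiset.replicate (Fintype.card ι) 0 + Finset.univ.val.map l =
      Multiset.replicate n 0 + Finset.univ.val.map hG.eigenvalues := by
  have h := congrArg Polynomial.roots (Matrix.charpoly_mul_comm' N Nᵀ)
  rw [Polynomial.roots_mul, Polynomial.roots_mul, hG.roots_charpoly_eq_eigenvalues, hl,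
    Polynomial.roots_prod _ _ (Finset.prod_ne_zero_iff.2 fun i _ => X_sub_C_ne_zero (l i))] at h
  · simpa [Multiset.nsmul_singleton] using h
  all_goals
    exact ((monic_X_pow _).mul (Matrix.charpoly_monic _)).ne_zero

/-- The `card ι`-th largest eigenvalue of `N * Nᵀ` is the least eigenvalue of `Nᵀ * N`. -/
theorem Matrix.le_root_iff_forall_le_eigenvalues {n : ℕ} {ι : Type*} [Fintype ι] [DecidableEq ι]
    (N : Matrix (Fin n) ι ℝ) (hG : (Nᵀ * N).IsHermitian) (l : Fin n → ℝ) (hanti : Antitone l)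
    (hl : (N * Nᵀ).charpoly = ∏ i, (X - C (l i))) (r : Fin n) (hr : r.val + 1 = Fintype.card ι)
    (t : ℝ) :
    t ≤ l r ↔ ∀ i, t ≤ hG.eigenvalues i := by
  have hroots := Matrix.replicate_zero_add_map_roots_eq N hG l hl
  have hnonneg : ∀ i, 0 ≤ hG.eigenvalues i := by
    have hpsd : (Nᵀ * N).PosSemidef := by
      simpa using Matrix.posSemidef_conjTranspose_mul_self N
    exact hpsd.eigenvalues_nonneg
  rcases le_or_gt t 0 with ht | ht
  · refine iff_of_true (ht.trans ?_) fun i => ht.trans (hnonneg i)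
    have hmem : l r ∈ Multiset.replicate n 0 + Finset.univ.val.map hG.eigenvalues := by
      rw [← hroots]
      exact Multiset.mem_add.2 (.inr (Multiset.mem_map_of_mem l (Finset.mem_univ r)))
    rcases Multiset.mem_add.1 hmem with h | h
    · exact (Multiset.eq_of_mem_replicate h).ge
    · obtain ⟨i, -, hi⟩ := Multiset.mem_map.1 h
      exact hi ▸ hnonneg i
  · have hcount : (Finset.univ.filter fun i => t ≤ l i).card =
        (Finset.univ.filter fun i => t ≤ hG.eigenvalues i).card := by
      have h := congrArg (Multiset.countP fun x => t ≤ x) hroots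
      have hz (k : ℕ) : (Multiset.replicate k (0 : ℝ)).countP (fun x => t ≤ x) = 0 :=
        Multiset.countP_eq_zero.2 fun a ha => by
          rw [Multiset.eq_of_mem_replicate ha]; exact ht.not_ge
      simp only [Multiset.countP_add, hz, Multiset.countP_map, zero_add] at h
      exact h
    have hall : (∀ i, t ≤ hG.eigenvalues i) ↔
        Fintype.card ι ≤ (Finset.univ.filter fun i => t ≤ hG.eigenvalues i).card := by
      rw [← Finset.card_univ]
      refine ⟨fun h => by simp [h], fun h i => ?_⟩
      have := Finset.eq_of_subset_of_card_le (Finset.filter_subset _ _) h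
      simpa using this.ge (Finset.mem_univ i)
    rw [hall, ← hcount, ← hr]
    constructor
    · intro h
      rw [← Fin.card_Iic]
      exact Finset.card_le_card fun i hi => by
        simpa using h.trans (hanti (Finset.mem_Iic.1 hi))
    · intro h
      by_contra! hlt
      have hsub : (Finset.univ.filter fun i => t ≤ l i) ⊆ Finset.Iio r := fun i hi => by
        rw [Finset.mem_Iio]
        by_contra! hri
        exact absurd (hlt.trans_le (Finset.mem_filter.1 hi).2) (hanti hri).not_gt
      have := Finset.card_le_card hsub
      rw [Fin.card_Iio] at this
      omega

/-- The `#S`-th largest eigenvalue of `∑ k ∈ S, X_k X_kᵀ` is at least `t` exactly when the Gram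
quadratic form of the columns indexed by `S` is bounded below by `t`. -/
theorem Matrix.le_root_sum_vecMulVec_iff {n p : ℕ} (X : Matrix (Fin n) (Fin p) ℝ)
    (S : Finset (Fin p)) (l : Fin n → ℝ) (hanti : Antitone l)
    (hl : (∑ k ∈ S, vecMulVec (fun i => X i k) (fun i => X i k)).charpoly =
      ∏ i, (Polynomial.X - C (l i)))
    (r : Fin n) (hr : r.val + 1 = S.card) (t : ℝ) :
    t ≤ l r ↔ ∀ v : Fin p → ℝ, t * ∑ k ∈ S, v k ^ 2 ≤
      (∑ k ∈ S, v k • fun i => X i k) ⬝ᵥ (∑ k ∈ S, v k • fun i => X i k) := by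
  let N : Matrix (Fin n) S ℝ := X.submatrix id Subtype.val
  have hN : N * Nᵀ = ∑ k ∈ S, vecMulVec (fun i => X i k) (fun i => X i k) := by
    ext a b
    simp only [N, Matrix.mul_apply, Matrix.sum_apply, vecMulVec_apply, transpose_apply,
      submatrix_apply, id]
    exact Finset.sum_coe_sort S fun k => X a k * X b k
  have hG : (Nᵀ * N).IsHermitian := by
    simpa using Matrix.isHermitian_conjTranspose_mul_self N
  have hmul (v : Fin p → ℝ) :
      N *ᵥ (fun k => v k.1) = ∑ k ∈ S, v k • fun i => X i k := by
    ext a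
    simp only [N, Matrix.mulVec, dotProduct, Finset.sum_apply, Pi.smul_apply, smul_eq_mul,
      submatrix_apply, id]
    rw [← Finset.sum_coe_sort S]
    exact Finset.sum_congr rfl fun k _ => mul_comm _ _
  have hsq (v : Fin p → ℝ) :
      (fun k : S => v k.1) ⬝ᵥ (fun k : S => v k.1) = ∑ k ∈ S, v k ^ 2 := by
    rw [← Finset.sum_coe_sort S]
    exact Finset.sum_congr rfl fun k _ => (sq _).symm
  rw [Matrix.le_root_iff_forall_le_eigenvalues N hG l hanti (hN ▸ hl) r (by simpa using hr) t,
    hG.forall_le_eigenvalues_iff]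
  have hquad (w : S → ℝ) : w ⬝ᵥ ((Nᵀ * N) *ᵥ w) = (N *ᵥ w) ⬝ᵥ (N *ᵥ w) := by
    rw [← Matrix.mulVec_mulVec, Matrix.dotProduct_mulVec, Matrix.vecMul_transpose]
  simp only [hquad]
  constructor
  · intro h v
    simpa only [hmul, hsq] using h fun k => v k.1
  · intro h w
    obtain ⟨v, rfl⟩ : ∃ v : Fin p → ℝ, w = fun k => v k.1 :=
      ⟨fun k => if hk : k ∈ S then w ⟨k, hk⟩ else 0, by ext k; simp⟩
    simpa only [hmul, hsq] using h v

/-- A binary quadratic form with nonnegative diagonal and nonnegative determinant, evaluated at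
`(a, 1)`, is nonnegative. -/
theorem quadratic_nonneg_of_sq_le_mul {P Q q : ℝ} (hP : 0 ≤ P) (hQ : 0 ≤ Q) (h : q ^ 2 ≤ P * Q)
    (a : ℝ) : 0 ≤ P * a ^ 2 + 2 * a * q + Q := by
  rcases hP.eq_or_lt with rfl | hP
  · have : q = 0 := by nlinarith [sq_nonneg q]
    simp [this, hQ]
  · refine nonneg_of_mul_nonneg_right ?_ hP
    nlinarith [sq_nonneg (P * a + q)]

/-- Lower bound on the `(s₀+1)`-th largest eigenvalue of `X_{T₀}X_{T₀}ᵀ + X_j X_jᵀ`. -/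
theorem eigenvalue_append_column_sqrt_bound
    {n p : ℕ} (X : Matrix (Fin n) (Fin p) ℝ)
    (hunit : ∀ j : Fin p, (fun i => X i j) ⬝ᵥ (fun i => X i j) = 1)
    (T₀ : Finset (Fin p)) (s₀ : ℕ) (hT₀ : T₀.card = s₀)
    (hs₀ : 0 < s₀) (hs₀n : s₀ < n)
    (j : Fin p) (hj : j ∉ T₀)
    (A : Matrix (Fin n) (Fin n) ℝ)
    (hA : A = ∑ k ∈ T₀, Matrix.vecMulVec (fun i => X i k) (fun i => X i k))
    (hrank : A.rank = s₀)
    (l : Fin n → ℝ) (hl : Antitone l)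
    (hlA : A.charpoly = ∏ i : Fin n, (Polynomial.X - Polynomial.C (l i)))
    (m : Fin n → ℝ) (hm : Antitone m)
    (hmB : (A + Matrix.vecMulVec (fun i => X i j) (fun i => X i j)).charpoly
      = ∏ i : Fin n, (Polynomial.X - Polynomial.C (m i))) :
    (1 + l ⟨s₀ - 1, by omega⟩
        - Real.sqrt ((1 - l ⟨s₀ - 1, by omega⟩) ^ 2
            + 4 * ∑ k ∈ T₀, ((fun i => X i k) ⬝ᵥ (fun i => X i j)) ^ 2)) / 2
      ≤ m ⟨s₀, hs₀n⟩ := by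
  subst hA
  have hgram := (Matrix.le_root_sum_vecMulVec_iff X T₀ l hl hlA ⟨s₀ - 1, by omega⟩
    (by simp only; omega) _).1 le_rfl
  rw [add_comm, ← Finset.sum_insert (f := fun k => vecMulVec (fun i => X i k) fun i => X i k) hj]
    at hmB
  rw [Matrix.le_root_sum_vecMulVec_iff X (insert j T₀) m hm hmB ⟨s₀, hs₀n⟩
    (by simp [Finset.card_insert_of_notMem hj, hT₀])]
  intro v
  rw [Finset.sum_insert hj, Finset.sum_insert hj]
  have hu := hgram v
  set lam := l ⟨s₀ - 1, by omega⟩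
  set b := ∑ k ∈ T₀, ((fun i => X i k) ⬝ᵥ (fun i => X i j)) ^ 2
  set u := ∑ k ∈ T₀, v k • fun i => X i k with hudef
  set w := ∑ k ∈ T₀, v k ^ 2
  set q := u ⬝ᵥ (fun i => X i j) with hq
  have hb0 : 0 ≤ b := Finset.sum_nonneg fun _ _ => sq_nonneg _
  have hw0 : 0 ≤ w := Finset.sum_nonneg fun _ _ => sq_nonneg _
  have hqw : q ^ 2 ≤ w * b := by
    have hqsum : q = ∑ k ∈ T₀, v k * ((fun i => X i k) ⬝ᵥ (fun i => X i j)) := by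
      simp [hq, hudef, sum_dotProduct]
    rw [hqsum]
    exact Finset.sum_mul_sq_le_sq_mul_sq _ _ _
  have hexp : (v j • (fun i => X i j) + u) ⬝ᵥ (v j • (fun i => X i j) + u) =
      v j ^ 2 + 2 * v j * q + u ⬝ᵥ u := by
    simp only [add_dotProduct, dotProduct_add, smul_dotProduct, dotProduct_smul, smul_eq_mul,
      hunit, dotProduct_comm (fun i => X i j) u, ← hq]
    ring
  rw [hexp]
  have hs := Real.sq_sqrt (show 0 ≤ (1 - lam) ^ 2 + 4 * b by positivity)
  have habs : |1 - lam| ≤ √((1 - lam) ^ 2 + 4 * b) := Real.abs_le_sqrt (by linarith)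
  set s := √((1 - lam) ^ 2 + 4 * b)
  obtain ⟨h₁, h₂⟩ := abs_le.1 habs
  have hP : 0 ≤ 1 - (1 + lam - s) / 2 := by linarith
  have hQ : 0 ≤ lam - (1 + lam - s) / 2 := by linarith
  have hdet : (1 - (1 + lam - s) / 2) * (lam - (1 + lam - s) / 2) = b := by nlinarith
  have := quadratic_nonneg_of_sq_le_mul hP (mul_nonneg hQ hw0)
    (q := q) (by rw [← mul_assoc, hdet]; linarith) (v j)
  linarith
end

section
/- Let X ∈ ℝ^{n×p} have ℓ₂-normalized columns, T₀ ⊂ {1,...,p} with |T₀| = s₀ and X_{T₀} of full column rank, and j ∉ T₀. Then λ_{s₀+1}(X_{T₀}X_{T₀}ᵗ + X_jX_jᵗ) ≥ λ_{s₀}(X_{T₀}X_{T₀}ᵗ) − min(‖X_{T₀}ᵗ X_j‖₂, ‖X_{T₀}ᵗ X_j‖₂²/(1 − λ_{s₀}(X_{T₀}X_{T₀}ᵗ))). -/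
open Matrix Polynomial BigOperators

open scoped MatrixOrder Matrix.Norms.L2Operator in
/-- A real symmetric matrix has quadratic form bounded below by `t` iff all its eigenvalues are
at least `t`. -/
lemma Matrix.IsHermitian.forall_mul_dotProduct_le_iff_forall_le_eigenvalues
    {ι : Type*} [Fintype ι] [DecidableEq ι] {H : Matrix ι ι ℝ} (hH : H.IsHermitian) (t : ℝ) :
    (∀ a : ι → ℝ, t * (a ⬝ᵥ a) ≤ a ⬝ᵥ (H *ᵥ a)) ↔ ∀ i, t ≤ hH.eigenvalues i := by
  have hspec : algebraMap ℝ (Matrix ι ι ℝ) t ≤ H ↔ ∀ x ∈ spectrum ℝ H, t ≤ x :=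
    algebraMap_le_iff_le_spectrum (ha := hH)
  rw [hH.spectrum_real_eq_range_eigenvalues, Set.forall_mem_range] at hspec
  rw [← hspec, Matrix.le_iff, Matrix.posSemidef_iff_dotProduct_mulVec]
  have hform (a : ι → ℝ) : star a ⬝ᵥ ((H - algebraMap ℝ (Matrix ι ι ℝ) t) *ᵥ a)
      = a ⬝ᵥ (H *ᵥ a) - t * (a ⬝ᵥ a) := by
    simp [Algebra.algebraMap_eq_smul_one, sub_mulVec, smul_mulVec, dotProduct_sub]
  have hherm : (H - algebraMap ℝ (Matrix ι ι ℝ) t).IsHermitian := by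
    refine hH.sub ?_
    simp [Algebra.algebraMap_eq_smul_one, IsHermitian]
  simp only [hform, sub_nonneg, hherm, true_and]

/-- The `k`-th entry (counting from zero) of a decreasing family is at least `t` iff at most
`n - (k + 1)` entries are below `t`. -/
lemma Antitone.le_apply_iff_card_filter_lt_le {n : ℕ} {l : Fin n → ℝ} (hl : Antitone l)
    (k : Fin n) (t : ℝ) :
    t ≤ l k ↔ (Finset.univ.filter fun i => l i < t).card ≤ n - (k + 1) := by
  constructor
  · intro h
    calc _ ≤ (Finset.Ioi k).card := by
          refine Finset.card_le_card fun i hi => ?_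
          simp only [Finset.mem_filter, Finset.mem_univ, true_and] at hi
          by_contra hik
          exact absurd (hl (not_lt.mp (by simpa using hik))) (by linarith)
      _ = _ := by rw [Fin.card_Ioi]; omega
  · intro h
    by_contra! hlt
    have : (Finset.Ici k).card ≤ (Finset.univ.filter fun i => l i < t).card :=
      Finset.card_le_card fun i hi => by
        simpa using (hl (Finset.mem_Ici.mp hi)).trans_lt hlt
    rw [Fin.card_Ici] at this
    omega

/-- For `M` with `k + 1` columns, at most as many as rows, the `(k + 1)`-st largest eigenvalue of
`M Mᵀ` is the best lower bound for the quadratic form of `Mᵀ M`. -/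
lemma Matrix.le_apply_iff_forall_mul_dotProduct_le
    {n : ℕ} {ι : Type*} [Fintype ι] [DecidableEq ι] (M : Matrix (Fin n) ι ℝ)
    {l : Fin n → ℝ} (hl : Antitone l)
    (hM : (M * Mᵀ).charpoly = ∏ i, (Polynomial.X - Polynomial.C (l i)))
    (k : Fin n) (hk : (k : ℕ) + 1 = Fintype.card ι) (t : ℝ) :
    t ≤ l k ↔ ∀ a : ι → ℝ, t * (a ⬝ᵥ a) ≤ (M *ᵥ a) ⬝ᵥ (M *ᵥ a) := by
  have hpsd : (Mᵀ * M).PosSemidef := by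
    simpa using Matrix.posSemidef_conjTranspose_mul_self M
  have hH := hpsd.isHermitian
  have hnonneg := hpsd.eigenvalues_nonneg
  have hform (a : ι → ℝ) : (M *ᵥ a) ⬝ᵥ (M *ᵥ a) = a ⬝ᵥ ((Mᵀ * M) *ᵥ a) := by
    rw [← mulVec_mulVec, dotProduct_mulVec a, vecMul_transpose]
  simp only [hform]
  rw [hH.forall_mul_dotProduct_le_iff_forall_le_eigenvalues,
    hl.le_apply_iff_card_filter_lt_le, hk]
  have hchar := Matrix.charpoly_mul_comm' M Mᵀ
  rw [hM, hH.charpoly_eq] at hchar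
  have hroots : Multiset.replicate (Fintype.card ι) (0 : ℝ) + Finset.univ.val.map l
      = Multiset.replicate n 0 + Finset.univ.val.map hH.eigenvalues := by
    have hl0 : (∏ i, (Polynomial.X - Polynomial.C (l i))) ≠ 0 :=
      (Polynomial.monic_prod_X_sub_C l Finset.univ).ne_zero
    have he0 : (∏ i, (Polynomial.X - Polynomial.C (hH.eigenvalues i))) ≠ 0 :=
      (Polynomial.monic_prod_X_sub_C hH.eigenvalues Finset.univ).ne_zero
    have h := congrArg Polynomial.roots hchar
    simp only [RCLike.ofReal_real_eq_id, id_eq, Fintype.card_fin] at h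
    rw [Polynomial.roots_mul (mul_ne_zero (by simp) hl0),
      Polynomial.roots_mul (mul_ne_zero (by simp) he0), Polynomial.roots_X_pow,
      Polynomial.roots_X_pow, Polynomial.roots_prod _ _ hl0, Polynomial.roots_prod _ _ he0] at h
    simpa [Multiset.nsmul_singleton] using h
  have hrep (c : ℕ) : (Multiset.replicate c (0 : ℝ)).countP (· < t) = if 0 < t then c else 0 := by
    rw [← Multiset.coe_replicate, Multiset.coe_countP, List.countP_replicate]
    simp
  have hcount := congrArg (Multiset.countP (· < t)) hroots
  simp only [Multiset.countP_add, Multiset.countP_map, hrep] at hcount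
  change _ + (Finset.univ.filter fun i => l i < t).card
    = _ + (Finset.univ.filter fun i => hH.eigenvalues i < t).card at hcount
  have hzero : (∀ i, t ≤ hH.eigenvalues i) ↔
      (Finset.univ.filter fun i => hH.eigenvalues i < t).card = 0 := by
    simp [Finset.filter_eq_empty_iff]
  have hneg : t ≤ 0 → (Finset.univ.filter fun i => hH.eigenvalues i < t).card = 0 :=
    fun ht => hzero.mp fun i => ht.trans (hnonneg i)
  rw [hzero]
  have := k.isLt
  split_ifs at hcount with ht
  · omega
  · have := hneg (not_lt.mp ht)
    omega

/-- If `d (1 - r + d) ≥ q`, then the quadratic form with blocks `S ≥ r P` and `1`, coupled by `w`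
with `w² ≤ P q`, is bounded below by `r - d`. -/
lemma sub_mul_add_sq_le_of_sq_le_mul {r d q P S w b : ℝ} (hr : r < 1) (hd : 0 ≤ d)
    (hq : q ≤ d * (1 - r + d)) (hP : 0 ≤ P) (hS : r * P ≤ S) (hw : w ^ 2 ≤ P * q) :
    (r - d) * (P + b ^ 2) ≤ S + 2 * b * w + b ^ 2 := by
  have hf : 0 < 1 - r + d := by linarith
  have hPq : P * q ≤ P * (d * (1 - r + d)) := mul_le_mul_of_nonneg_left hq hP
  have hprod : 0 ≤ (1 - r + d) * (d * P + 2 * b * w + (1 - r + d) * b ^ 2) := by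
    nlinarith [sq_nonneg (w + (1 - r + d) * b)]
  have := nonneg_of_mul_nonneg_right hprod hf
  linarith

lemma min_sqrt_div_nonneg_and_le {r q : ℝ} (hr : r < 1) (hq : 0 ≤ q) :
    0 ≤ min (Real.sqrt q) (q / (1 - r)) ∧
      q ≤ min (Real.sqrt q) (q / (1 - r)) * (1 - r + min (Real.sqrt q) (q / (1 - r))) := by
  have hr' : 0 < 1 - r := by linarith
  refine ⟨le_min (Real.sqrt_nonneg q) (by positivity), ?_⟩
  rcases min_choice (Real.sqrt q) (q / (1 - r)) with h | h <;> rw [h]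
  · nlinarith [Real.sq_sqrt hq, Real.sqrt_nonneg q]
  · have : q / (1 - r) * (1 - r) = q := by field_simp
    nlinarith [sq_nonneg (q / (1 - r))]

/-- Main perturbation bound (Theorem 2): appending one column,
`λ_{s₀+1}(A + X_jX_jᵀ) ≥ λ_{s₀}(A) − min(‖X_{T₀}ᵀX_j‖₂, ‖X_{T₀}ᵀX_j‖₂²/(1−λ_{s₀}(A)))`. -/
theorem eigenvalue_append_column_min_bound
    {n p : ℕ} (X : Matrix (Fin n) (Fin p) ℝ)
    (hunit : ∀ j : Fin p, (fun i => X i j) ⬝ᵥ (fun i => X i j) = 1)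
    (T₀ : Finset (Fin p)) (s₀ : ℕ) (hT₀ : T₀.card = s₀)
    (hs₀ : 0 < s₀) (hs₀n : s₀ < n)
    (j : Fin p) (hj : j ∉ T₀)
    (A : Matrix (Fin n) (Fin n) ℝ)
    (hA : A = ∑ k ∈ T₀, Matrix.vecMulVec (fun i => X i k) (fun i => X i k))
    (hrank : A.rank = s₀)
    (l : Fin n → ℝ) (hl : Antitone l)
    (hlA : A.charpoly = ∏ i : Fin n, (Polynomial.X - Polynomial.C (l i)))
    (hl1 : l ⟨s₀ - 1, by omega⟩ < 1)
    (m : Fin n → ℝ) (hm : Antitone m)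
    (hmB : (A + Matrix.vecMulVec (fun i => X i j) (fun i => X i j)).charpoly
      = ∏ i : Fin n, (Polynomial.X - Polynomial.C (m i))) :
    l ⟨s₀ - 1, by omega⟩
        - min (Real.sqrt (∑ k ∈ T₀, ((fun i => X i k) ⬝ᵥ (fun i => X i j)) ^ 2))
            ((∑ k ∈ T₀, ((fun i => X i k) ⬝ᵥ (fun i => X i j)) ^ 2)
              / (1 - l ⟨s₀ - 1, by omega⟩))
      ≤ m ⟨s₀, hs₀n⟩ := by
  set x : Fin n → ℝ := fun i => X i j
  set q : ℝ := ∑ k ∈ T₀, ((fun i => X i k) ⬝ᵥ x) ^ 2 with hq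
  set M : Matrix (Fin n) T₀ ℝ := Matrix.of fun i k => X i k
  set N : Matrix (Fin n) (Option T₀) ℝ :=
    Matrix.of fun i o => o.elim (X i j) (fun k => X i k)
  have hMA : M * Mᵀ = A := by
    ext i i'
    rw [hA, Matrix.sum_apply, Matrix.mul_apply, ← Finset.sum_coe_sort T₀]
    rfl
  have hNB : N * Nᵀ = A + Matrix.vecMulVec x x := by
    ext i i'
    rw [← hMA, Matrix.mul_apply, Fintype.sum_option, Matrix.add_apply, Matrix.mul_apply, add_comm]
    rfl
  have hlower := (Matrix.le_apply_iff_forall_mul_dotProduct_le M hl (hMA ▸ hlA)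
    ⟨s₀ - 1, by omega⟩ (by simp [hT₀]; omega) _).mp le_rfl
  refine (Matrix.le_apply_iff_forall_mul_dotProduct_le N hm (hNB ▸ hmB)
    ⟨s₀, hs₀n⟩ (by simp [hT₀]) _).mpr fun a => ?_
  set r := l ⟨s₀ - 1, by omega⟩
  set c : T₀ → ℝ := fun k => a (some k) with hc
  have hNa : N *ᵥ a = M *ᵥ c + a none • x := by
    ext i
    simp only [mulVec, dotProduct, Fintype.sum_option, Pi.add_apply, Pi.smul_apply, smul_eq_mul]
    rw [add_comm, mul_comm]
    rfl
  have haa : a ⬝ᵥ a = c ⬝ᵥ c + a none ^ 2 := by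
    simp only [dotProduct, Fintype.sum_option, hc]
    ring
  have hexpand : (N *ᵥ a) ⬝ᵥ (N *ᵥ a)
      = (M *ᵥ c) ⬝ᵥ (M *ᵥ c) + 2 * a none * ((M *ᵥ c) ⬝ᵥ x) + a none ^ 2 := by
    have hxx : x ⬝ᵥ x = 1 := hunit j
    rw [hNa]
    simp only [dotProduct_add, add_dotProduct, smul_dotProduct, dotProduct_smul, smul_eq_mul,
      hxx, dotProduct_comm x (M *ᵥ c)]
    ring
  have hcross : ((M *ᵥ c) ⬝ᵥ x) ^ 2 ≤ (c ⬝ᵥ c) * q := by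
    have hcoef : (M *ᵥ c) ⬝ᵥ x = ∑ k : T₀, c k * ((fun i => X i k) ⬝ᵥ x) := by
      rw [dotProduct_comm, dotProduct_mulVec, dotProduct_comm]
      exact Finset.sum_congr rfl fun k _ => congrArg (c k * ·) (dotProduct_comm _ _)
    have hcc : c ⬝ᵥ c = ∑ k, c k ^ 2 := by simp [dotProduct, sq]
    rw [hcoef, hcc, hq, ← Finset.sum_coe_sort T₀]
    exact Finset.sum_mul_sq_le_sq_mul_sq _ _ _
  have hq0 : 0 ≤ q := Finset.sum_nonneg fun k _ => sq_nonneg _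
  obtain ⟨hd, hqd⟩ := min_sqrt_div_nonneg_and_le hl1 hq0
  rw [haa, hexpand]
  exact sub_mul_add_sq_le_of_sq_le_mul hl1 hd hqd
    (Finset.sum_nonneg fun k _ => mul_self_nonneg _) (hlower c) hcross
end

section
/- Let X ∈ ℝ^{n×p} have ℓ₂-normalized columns and coherence μ, let T₀ ⊂ {1,...,p} with |T₀| = s₀ and X_{T₀} of full column rank, and let j ∉ T₀. Assume ‖X_{T₀}ᵗ X_j‖₂² ≤ α s₀ μ² for some α > 0. Then λ_{s₀+1}(X_{T₀}X_{T₀}ᵗ + X_jX_jᵗ) ≥ λ_{s₀}(X_{T₀}X_{T₀}ᵗ) − min(√(α s₀ μ²), α s₀ μ²/(1 − λ_{s₀}(X_{T₀}X_{T₀}ᵗ))). -/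
open Matrix Polynomial BigOperators

namespace Matrix

/-- For a real symmetric matrix, `t` bounds the spectrum from below iff it bounds the
quadratic form from below. -/
theorem IsHermitian.forall_mem_roots_charpoly_le_iff {ι : Type*} [Fintype ι] [DecidableEq ι]
    {M : Matrix ι ι ℝ} (hM : M.IsHermitian) (t : ℝ) :
    (∀ r ∈ M.charpoly.roots, t ≤ r) ↔ ∀ u : ι → ℝ, t * (u ⬝ᵥ u) ≤ u ⬝ᵥ (M *ᵥ u) := by
  have hH : (M - algebraMap ℝ (Matrix ι ι ℝ) t).IsHermitian :=
    hM.sub (by simp [Matrix.IsHermitian, algebraMap_eq_diagonal])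
  have hspec := posSemidef_iff_isHermitian_and_spectrum_nonneg
    (A := M - algebraMap ℝ (Matrix ι ι ℝ) t)
  rw [posSemidef_iff_dotProduct_mulVec, and_congr_right_iff] at hspec
  have hspec := hspec hH
  rw [← spectrum.sub_singleton_eq] at hspec
  have hform : (∀ u : ι → ℝ, t * (u ⬝ᵥ u) ≤ u ⬝ᵥ (M *ᵥ u)) ↔
      ∀ u : ι → ℝ, 0 ≤ star u ⬝ᵥ ((M - algebraMap ℝ (Matrix ι ι ℝ) t) *ᵥ u) := by
    refine forall_congr' fun u => ?_
    rw [sub_mulVec, dotProduct_sub, sub_nonneg, Algebra.algebraMap_eq_smul_one, smul_mulVec,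
      one_mulVec, dotProduct_smul, smul_eq_mul, star_trivial]
  rw [hform, hspec, Set.sub_singleton, Set.image_subset_iff]
  refine forall_congr' fun r => ?_
  rw [mem_spectrum_iff_isRoot_charpoly, mem_roots M.charpoly_monic.ne_zero]
  simp

theorem IsHermitian.card_roots_charpoly {ι : Type*} [Fintype ι] [DecidableEq ι]
    {M : Matrix ι ι ℝ} (hM : M.IsHermitian) :
    Multiset.card M.charpoly.roots = Fintype.card ι := by
  rw [hM.roots_charpoly_eq_eigenvalues]
  simp

/-- `Y * Yᵀ` and `Yᵀ * Y` have the same positive eigenvalues, with multiplicity. -/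
theorem countP_roots_charpoly_mul_transpose {κ ι : Type*} [Fintype κ] [DecidableEq κ]
    [Fintype ι] [DecidableEq ι] (Y : Matrix κ ι ℝ) {t : ℝ} (ht : 0 < t) :
    (Y * Yᵀ).charpoly.roots.countP (t ≤ ·) = (Yᵀ * Y).charpoly.roots.countP (t ≤ ·) := by
  have h := congrArg (fun q => q.roots.countP (t ≤ ·)) (charpoly_mul_comm' Y Yᵀ)
  have hX : ∀ k : ℕ, ((X : ℝ[X]) ^ k).roots.countP (t ≤ ·) = 0 := by
    intro k
    rw [roots_X_pow, Multiset.countP_nsmul, Multiset.countP_eq_zero.mpr (by simpa using ht),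
      mul_zero]
  have hne : ∀ (k : ℕ) {q : ℝ[X]}, q.Monic → X ^ k * q ≠ 0 := fun k q hq =>
    ((monic_X_pow k).mul hq).ne_zero
  simpa only [roots_mul (hne _ (charpoly_monic _)), Multiset.countP_add, hX, zero_add] using h

end Matrix

/-- A decreasing sequence is at least `t` at index `k` iff it has more than `k` terms that are
at least `t`. -/
theorem Antitone.le_apply_iff_lt_card_filter {n : ℕ} {l : Fin n → ℝ} (hl : Antitone l)
    (t : ℝ) (k : Fin n) :
    t ≤ l k ↔ (k : ℕ) < (Finset.univ.filter fun i => t ≤ l i).card := by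
  constructor
  · intro h
    have hsub : Finset.Iic k ⊆ Finset.univ.filter fun i => t ≤ l i := fun i hi => by
      simpa using h.trans (hl (Finset.mem_Iic.mp hi))
    have hcard := Finset.card_le_card hsub
    rw [Fin.card_Iic] at hcard
    omega
  · intro h
    by_contra hk
    have hsub : (Finset.univ.filter fun i => t ≤ l i) ⊆ Finset.Iio k := fun i hi => by
      rw [Finset.mem_Iio]
      by_contra hik
      exact hk ((Finset.mem_filter.mp hi).2.trans (hl (not_lt.mp hik)))
    have hcard := Finset.card_le_card hsub
    rw [Fin.card_Iio] at hcard
    omega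

namespace Matrix

/-- The `#ι`-th largest eigenvalue of `Y * Yᵀ` is at least `t > 0` iff `t` bounds the Gram
quadratic form of the columns of `Y` from below. -/
theorem le_eigenvalue_mul_transpose_iff {n : ℕ} {ι : Type*} [Fintype ι] [DecidableEq ι]
    (Y : Matrix (Fin n) ι ℝ) {l : Fin n → ℝ} (hl : Antitone l)
    (hY : (Y * Yᵀ).charpoly = ∏ i, (X - C (l i))) {t : ℝ} (ht : 0 < t)
    (k : Fin n) (hk : (k : ℕ) + 1 = Fintype.card ι) :
    t ≤ l k ↔ ∀ u : ι → ℝ, t * (u ⬝ᵥ u) ≤ (Y *ᵥ u) ⬝ᵥ (Y *ᵥ u) := by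
  have hG : (Yᵀ * Y).IsHermitian := by
    simpa using isHermitian_conjTranspose_mul_self Y
  have hroots : (Y * Yᵀ).charpoly.roots = Finset.univ.val.map l := by
    rw [hY, ← roots_multiset_prod_X_sub_C (Finset.univ.val.map l), Multiset.map_map]
    rfl
  have hcount := countP_roots_charpoly_mul_transpose Y ht
  rw [hroots, Multiset.countP_map] at hcount
  have hform : ∀ u : ι → ℝ, u ⬝ᵥ ((Yᵀ * Y) *ᵥ u) = (Y *ᵥ u) ⬝ᵥ (Y *ᵥ u) := fun u => by
    rw [← mulVec_mulVec, dotProduct_mulVec, vecMul_transpose]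
  have hfilter : (Finset.univ.filter fun i => t ≤ l i).card =
      (Yᵀ * Y).charpoly.roots.countP (t ≤ ·) := hcount
  rw [hl.le_apply_iff_lt_card_filter, hfilter, Nat.lt_iff_add_one_le, hk,
    ← hG.card_roots_charpoly, (Multiset.countP_le_card _ _).ge_iff_eq', eq_comm,
    Multiset.countP_eq_card, hG.forall_mem_roots_charpoly_le_iff]
  simp only [hform]

/-- Appending a unit column `x` to `P`: lower bound for the Gram quadratic form. -/
theorem mul_dotProduct_le_fromCols_replicateCol {κ ι : Type*} [Fintype κ] [Fintype ι]
    (P : Matrix κ ι ℝ) (x : κ → ℝ) (hx : x ⬝ᵥ x = 1) {a t c : ℝ}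
    (hP : ∀ u : ι → ℝ, a * (u ⬝ᵥ u) ≤ (P *ᵥ u) ⬝ᵥ (P *ᵥ u))
    (hc : (Pᵀ *ᵥ x) ⬝ᵥ (Pᵀ *ᵥ x) ≤ c) (ht : t < 1) (htc : c ≤ (a - t) * (1 - t))
    (u : ι ⊕ Unit → ℝ) :
    t * (u ⬝ᵥ u) ≤ (fromCols P (replicateCol Unit x) *ᵥ u) ⬝ᵥ
      (fromCols P (replicateCol Unit x) *ᵥ u) := by
  set v : ι → ℝ := u ∘ Sum.inl with hv
  set b : ℝ := u (Sum.inr ()) with hb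
  have hmul : fromCols P (replicateCol Unit x) *ᵥ u = P *ᵥ v + b • x := by
    rw [fromCols_mulVec]
    congr 1
    ext i
    simp [mulVec, dotProduct, hb, mul_comm]
  have hu : u ⬝ᵥ u = v ⬝ᵥ v + b * b := by
    simp [dotProduct, hv, hb]
  have hw : (P *ᵥ v) ⬝ᵥ x = v ⬝ᵥ (Pᵀ *ᵥ x) := by
    rw [dotProduct_mulVec, vecMul_transpose]
  have hcs : ((P *ᵥ v) ⬝ᵥ x) ^ 2 ≤ (v ⬝ᵥ v) * ((Pᵀ *ᵥ x) ⬝ᵥ (Pᵀ *ᵥ x)) := by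
    rw [hw]
    simpa only [dotProduct, sq] using
      Finset.sum_mul_sq_le_sq_mul_sq Finset.univ v (Pᵀ *ᵥ x)
  have hv0 : 0 ≤ v ⬝ᵥ v := Finset.sum_nonneg fun i _ => mul_self_nonneg (v i)
  rw [hmul, hu, add_dotProduct, dotProduct_add, dotProduct_add, smul_dotProduct, smul_dotProduct,
    dotProduct_smul, dotProduct_smul, hx, dotProduct_comm x]
  simp only [smul_eq_mul]
  have hPv := hP v
  set q := v ⬝ᵥ v
  set w := (P *ᵥ v) ⬝ᵥ x
  have hwq : w ^ 2 ≤ q * ((a - t) * (1 - t)) :=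
    hcs.trans (mul_le_mul_of_nonneg_left (hc.trans htc) hv0)
  have hmain : 0 ≤ (1 - t) * ((a - t) * q + 2 * b * w + (1 - t) * b ^ 2) := by
    nlinarith [sq_nonneg ((1 - t) * b + w)]
  have := nonneg_of_mul_nonneg_right hmain (sub_pos.mpr ht)
  linarith

end Matrix

/-- Corollary 3.3: perturbation bound in terms of the coherence,
assuming `‖X_{T₀}ᵀX_j‖₂² ≤ α s₀ μ²`. -/
theorem eigenvalue_append_column_coherence_bound
    {n p : ℕ} (X : Matrix (Fin n) (Fin p) ℝ)
    (hunit : ∀ j : Fin p, (fun i => X i j) ⬝ᵥ (fun i => X i j) = 1)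
    (μ : ℝ) (hμ0 : 0 ≤ μ)
    (hμ : ∀ k l : Fin p, k ≠ l → |(fun i => X i k) ⬝ᵥ (fun i => X i l)| ≤ μ)
    (T₀ : Finset (Fin p)) (s₀ : ℕ) (hT₀ : T₀.card = s₀)
    (hs₀ : 0 < s₀) (hs₀n : s₀ < n)
    (j : Fin p) (hj : j ∉ T₀)
    (A : Matrix (Fin n) (Fin n) ℝ)
    (hA : A = ∑ k ∈ T₀, Matrix.vecMulVec (fun i => X i k) (fun i => X i k))
    (hrank : A.rank = s₀)
    (α : ℝ) (hα : 0 < α)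
    (hbound : ∑ k ∈ T₀, ((fun i => X i k) ⬝ᵥ (fun i => X i j)) ^ 2 ≤ α * s₀ * μ ^ 2)
    (l : Fin n → ℝ) (hl : Antitone l)
    (hlA : A.charpoly = ∏ i : Fin n, (Polynomial.X - Polynomial.C (l i)))
    (hl1 : l ⟨s₀ - 1, by omega⟩ < 1)
    (m : Fin n → ℝ) (hm : Antitone m)
    (hmB : (A + Matrix.vecMulVec (fun i => X i j) (fun i => X i j)).charpoly
      = ∏ i : Fin n, (Polynomial.X - Polynomial.C (m i))) :
    l ⟨s₀ - 1, by omega⟩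
        - min (Real.sqrt (α * s₀ * μ ^ 2))
            (α * s₀ * μ ^ 2 / (1 - l ⟨s₀ - 1, by omega⟩))
      ≤ m ⟨s₀, hs₀n⟩ := by
  set x : Fin n → ℝ := fun i => X i j with hx
  set P : Matrix (Fin n) T₀ ℝ := X.submatrix id Subtype.val with hP
  set a := l ⟨s₀ - 1, by omega⟩ with ha
  set c := α * s₀ * μ ^ 2 with hc
  have hc0 : 0 ≤ c := by positivity
  have hAP : A = P * Pᵀ := by
    ext i k
    rw [hA, Matrix.sum_apply, Matrix.mul_apply, ← Finset.sum_coe_sort]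
    rfl
  set Y := fromCols P (replicateCol Unit x) with hY
  have hBY : A + vecMulVec x x = Y * Yᵀ := by
    rw [hY, transpose_fromCols, fromCols_mul_fromRows, hAP, vecMulVec_eq Unit]
    rfl
  rw [hBY] at hmB
  rw [hAP] at hlA
  set d := min (Real.sqrt c) (c / (1 - a)) with hd
  have h1a : 0 < 1 - a := sub_pos.mpr hl1
  have hd0 : 0 ≤ d := le_min (Real.sqrt_nonneg c) (div_nonneg hc0 h1a.le)
  rcases le_or_gt (a - d) 0 with ht | ht
  · have hpsd : (Y * Yᵀ).PosSemidef := by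
      simpa using posSemidef_self_mul_conjTranspose Y
    refine ht.trans ((hpsd.isHermitian.forall_mem_roots_charpoly_le_iff 0).mpr
      (fun u => by simpa using hpsd.dotProduct_mulVec_nonneg u) _ ?_)
    rw [mem_roots (charpoly_monic _).ne_zero, hmB, IsRoot, eval_prod]
    exact Finset.prod_eq_zero (Finset.mem_univ ⟨s₀, hs₀n⟩) (by simp)
  · have hform := (le_eigenvalue_mul_transpose_iff P hl hlA (t := a) (by linarith)
      ⟨s₀ - 1, by omega⟩ (by simp only [Fintype.card_coe]; omega)).mp le_rfl
    refine (le_eigenvalue_mul_transpose_iff Y hm hmB ht ⟨s₀, hs₀n⟩ (by simp [hT₀])).mpr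
      (mul_dotProduct_le_fromCols_replicateCol P x (hunit j) hform (c := c) ?_ (by linarith) ?_)
    · refine le_trans (le_of_eq ?_) hbound
      rw [← Finset.sum_coe_sort]
      simp only [dotProduct, sq]
      rfl
    · have hdc : c ≤ d * (1 - a + d) := by
        rcases min_choice (Real.sqrt c) (c / (1 - a)) with h | h <;> rw [← hd] at h
        · have hsq : d * d = c := by rw [h, Real.mul_self_sqrt hc0]
          nlinarith
        · have hmul : d * (1 - a) = c := by rw [h, div_mul_cancel₀ _ h1a.ne']
          nlinarith
      linarith
end
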